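/- (Explicit one-dimensional sticky solution) Let 0 < β < γ < 1 and 0 < α < 1/(1+β+γ). Set m_k = α^k, x̄_k = β^k, v̄_k = 1 − γ^k, x_k(t) = β^k + t(1−γ^k), b_k(t) = (Σ_{j≥k} α^j(β^j + t(1−γ^j)))/(Σ_{j≥k} α^j), and t_k = ((1−β)/(1−αβ))·((1−αγ)/(1−γ))·(β/γ)^k, so that t_k is strictly decreasing to 0, and put t_0 = ∞. Define y_k : [0,∞) → ℝ by y_k(t) = x_k(t) if t < t_k, and y_k(t) = b_j(t) if t ∈ [t_j, t_{j−1}) with j ≤ k. Then each y_k is continuous, and the family (y_k)_{k≥1} is a sticky solution of the one-dimensional sticky particle system with data (m_k, x̄_k, v̄_k): for t ∈ [t_j, t_{j−1}) the particles 1, …, j−1 are free at positions x_1(t), …, x_{j−1}(t) while all particles k ≥ j occupy the single position b_j(t). -/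

import Mathlib

open Set

/-- The free trajectory of the `k`-th particle. -/
def freeTraj (β γ : ℝ) (k : ℕ) (t : ℝ) : ℝ := β ^ k + t * (1 - γ ^ k)

/-- The barycenter at time `t` of the particles with masses `α^j` located at
`β^j + t(1-γ^j)`, for indices `j ≥ k`. -/
noncomputable def barycenter (α β γ : ℝ) (k : ℕ) (t : ℝ) : ℝ :=
  (∑' j : {j : ℕ // k ≤ j}, α ^ (j : ℕ) * (β ^ (j : ℕ) + t * (1 - γ ^ (j : ℕ)))) /
    (∑' j : {j : ℕ // k ≤ j}, α ^ (j : ℕ))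

/-- The collision time `t_k`. -/
noncomputable def collisionTime (α β γ : ℝ) (k : ℕ) : ℝ :=
  ((1 - β) / (1 - α * β)) * ((1 - α * γ) / (1 - γ)) * (β / γ) ^ k

/-- The common velocity, at time `s`, of the cluster of particles occupying the same
position as the `i`-th particle (one space dimension). -/
noncomputable def stickyVel {ι : Type*} (m vInit : ι → ℝ) (x : ι → ℝ → ℝ)
    (i : ι) (s : ℝ) : ℝ :=
  (∑' j : {j : ι // x j s = x i s}, m (j : ι))⁻¹ *
    ∑' j : {j : ι // x j s = x i s}, m (j : ι) * vInit (j : ι)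

/-- Weak solution of the one-dimensional sticky particle system on `[0,∞)`. -/
def IsWeakSolution {ι : Type*} (m xInit vInit : ι → ℝ) (x : ι → ℝ → ℝ) : Prop :=
  (∀ i, ContinuousOn (x i) (Ici (0 : ℝ))) ∧ (∀ i, x i 0 = xInit i) ∧
    ∀ i, ∀ t : ℝ, 0 ≤ t → x i t = xInit i + ∫ s in (0 : ℝ)..t, stickyVel m vInit x i s

/-- Sticky solution: a weak solution such that particles occupying the same position at
some time occupy the same position at all later times. -/
def IsStickySolution {ι : Type*} (m xInit vInit : ι → ℝ) (x : ι → ℝ → ℝ) : Prop :=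
  IsWeakSolution m xInit vInit x ∧
    ∀ i j, ∀ t₀ : ℝ, 0 ≤ t₀ → x i t₀ = x j t₀ → ∀ t, t₀ ≤ t → x i t = x j t

structure SP (α β γ : ℝ) : Prop where
  a0 : 0 < α
  a1 : α < 1
  b0 : 0 < β
  bg : β < γ
  g1 : γ < 1

namespace SP
variable {α β γ : ℝ}

theorem hasSum_ge {f : ℕ → ℝ} {s : ℝ} (k : ℕ) (h : HasSum (fun n => f (n + k)) s) :
    HasSum (fun j : {j : ℕ // k ≤ j} => f j) s := by
  let e : ℕ ≃ {j : ℕ // k ≤ j} :=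
    ⟨fun n => ⟨n + k, by omega⟩, fun j => j.1 - k, fun n => by simp,
      fun j => Subtype.ext (by have := j.2; simp; omega)⟩
  exact (e.hasSum_iff (f := fun j : {j : ℕ // k ≤ j} => f j)).1 h

theorem geo {r : ℝ} (h0 : 0 ≤ r) (h1 : r < 1) (k : ℕ) :
    HasSum (fun j : {j : ℕ // k ≤ j} => r ^ (j : ℕ)) (r ^ k / (1 - r)) := by
  refine hasSum_ge (f := fun j => r ^ j) k ?_
  have := (hasSum_geometric_of_lt_one h0 h1).mul_left (r ^ k)
  refine (this.congr_fun ?_)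
  intro n; simp [pow_add, mul_comm]

theorem pos1 (H : SP α β γ) : 0 < 1 - α * β := by
  have := H.a0; have := H.a1; have := H.b0; have := H.bg; have := H.g1; nlinarith
theorem pos2 (H : SP α β γ) : 0 < 1 - α * γ := by
  have := H.a0; have := H.a1; have := H.b0; have := H.bg; have := H.g1; nlinarith
theorem g0 (H : SP α β γ) : 0 < γ := H.b0.trans H.bg

theorem sumv (H : SP α β γ) (k : ℕ) :
    HasSum (fun j : {j : ℕ // k ≤ j} => α ^ (j : ℕ) * (1 - γ ^ (j : ℕ)))
      (α ^ k / (1 - α) - (α * γ) ^ k / (1 - α * γ)) := by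
  have h1 := geo H.a0.le H.a1 k
  have h2 := geo (mul_pos H.a0 H.g0).le (by linarith [H.pos2]) k
  refine (h1.sub h2).congr_fun ?_
  intro j; simp only [mul_pow]; ring

theorem vel_eq (H : SP α β γ) (k : ℕ) :
    (∑' j : {j : ℕ // k ≤ j}, α ^ (j : ℕ))⁻¹ *
      ∑' j : {j : ℕ // k ≤ j}, α ^ (j : ℕ) * (1 - γ ^ (j : ℕ)) =
    1 - γ ^ k * ((1 - α) / (1 - α * γ)) := by
  rw [(geo H.a0.le H.a1 k).tsum_eq, (sumv H k).tsum_eq]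
  have := H.pos2; have := H.a0; have : 0 < 1 - α := by linarith [H.a1]
  rw [mul_pow]
  field_simp

theorem bary_eq (H : SP α β γ) (k : ℕ) (t : ℝ) :
    barycenter α β γ k t = β ^ k * ((1 - α) / (1 - α * β)) +
      t * (1 - γ ^ k * ((1 - α) / (1 - α * γ))) := by
  unfold barycenter
  have h2 := geo (mul_pos H.a0 H.b0).le (by linarith [H.pos1]) k
  have h3 := h2.add ((sumv H k).mul_left t)
  have h4 : HasSum (fun j : {j : ℕ // k ≤ j} =>
      α ^ (j : ℕ) * (β ^ (j : ℕ) + t * (1 - γ ^ (j : ℕ))))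
      ((α * β) ^ k / (1 - α * β) + t * (α ^ k / (1 - α) - (α * γ) ^ k / (1 - α * γ))) := by
    refine h3.congr_fun ?_
    intro j; simp only [mul_pow]; ring
  rw [(geo H.a0.le H.a1 k).tsum_eq, h4.tsum_eq]
  have := H.pos1
  have := H.pos2; have := H.a0; have : 0 < 1 - α := by linarith [H.a1]
  rw [mul_pow, mul_pow]
  field_simp

theorem key (H : SP α β γ) (k : ℕ) :
    collisionTime α β γ k * (γ ^ k * ((1 - γ) / (1 - α * γ))) = β ^ k * ((1 - β) / (1 - α * β)) := by
  unfold collisionTime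
  have := H.pos1; have := H.pos2; have := H.g0
  have : 0 < 1 - γ := by linarith [H.g1]
  rw [div_pow]
  field_simp

theorem T_pos (H : SP α β γ) (k : ℕ) : 0 < collisionTime α β γ k := by
  unfold collisionTime
  have := H.pos1; have := H.pos2; have := H.g0; have := H.b0
  have : 0 < 1 - γ := by linarith [H.g1]
  have : 0 < 1 - β := by linarith [H.g1, H.bg]
  positivity

theorem T_anti (H : SP α β γ) : StrictAnti (collisionTime α β γ) := by
  have h := H.T_pos 0
  intro i j hij
  unfold collisionTime at *
  rw [pow_zero, mul_one] at h
  refine mul_lt_mul_of_pos_left ?_ h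
  exact pow_lt_pow_right_of_lt_one₀ (div_pos H.b0 H.g0) ((div_lt_one H.g0).2 H.bg) hij

theorem T_small (H : SP α β γ) {t : ℝ} (ht : 0 < t) : ∃ k, 1 ≤ k ∧ collisionTime α β γ k ≤ t := by
  have h := (tendsto_pow_atTop_nhds_zero_of_lt_one (div_pos H.b0 H.g0).le
    ((div_lt_one H.g0).2 H.bg)).const_mul
      (((1 - β) / (1 - α * β)) * ((1 - α * γ) / (1 - γ)))
  rw [mul_zero] at h
  obtain ⟨k, hk1, hk2⟩ := ((h.eventually (gt_mem_nhds ht)).and (Filter.eventually_ge_atTop 1)).exists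
  exact ⟨k, hk2, hk1.le⟩

theorem free_bary (H : SP α β γ) (k : ℕ) (t : ℝ) :
    freeTraj β γ k t - barycenter α β γ (k + 1) t =
      (collisionTime α β γ k - t) * (γ ^ k * ((1 - γ) / (1 - α * γ))) := by
  rw [sub_mul, H.key, H.bary_eq, freeTraj]
  have := H.pos1; have := H.pos2
  field_simp
  ring

theorem bary_bary (H : SP α β γ) (k : ℕ) (t : ℝ) :
    barycenter α β γ k t - barycenter α β γ (k + 1) t =
      (1 - α) * ((collisionTime α β γ k - t) * (γ ^ k * ((1 - γ) / (1 - α * γ)))) := by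
  rw [sub_mul (collisionTime α β γ k), H.key, H.bary_eq, H.bary_eq]
  have := H.pos1; have := H.pos2
  field_simp
  ring

theorem bary_coll (H : SP α β γ) (k : ℕ) :
    barycenter α β γ (k + 1) (collisionTime α β γ k) =
      barycenter α β γ k (collisionTime α β γ k) := by
  have := H.bary_bary k (collisionTime α β γ k)
  simp at this; linarith

theorem free_coll (H : SP α β γ) (k : ℕ) :
    freeTraj β γ k (collisionTime α β γ k) =
      barycenter α β γ k (collisionTime α β γ k) := by
  have := H.free_bary k (collisionTime α β γ k)
  have := H.bary_coll k
  simp at *; linarith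

theorem bary_lt_free (H : SP α β γ) (k : ℕ) {t : ℝ} (h : t < collisionTime α β γ k) :
    barycenter α β γ (k + 1) t < freeTraj β γ k t := by
  have := H.free_bary k t
  have h2 := H.pos2; have h3 := H.g0
  have h4 : 0 < 1 - γ := by linarith [H.g1]
  have : 0 < (collisionTime α β γ k - t) * (γ ^ k * ((1 - γ) / (1 - α * γ))) :=
    mul_pos (by linarith) (by positivity)
  linarith

theorem free_succ (H : SP α β γ) (k : ℕ) {t : ℝ} (ht : t < collisionTime α β γ (k+1)) :
    freeTraj β γ (k+1) t < freeTraj β γ k t := by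
  have h0 := H.key (k+1)
  have h2 := H.pos2; have h3 := H.g0; have h1 := H.pos1; have hb := H.b0
  have h4 : 0 < 1 - γ := by linarith [H.g1]
  have h5 : 0 < 1 - β := by linarith [H.g1, H.bg]
  have e : freeTraj β γ k t - freeTraj β γ (k+1) t = β ^ k * (1 - β) - t * (γ ^ k * (1 - γ)) := by
    unfold freeTraj; ring
  have a1 : t * (γ ^ k * (1 - γ)) < collisionTime α β γ (k+1) * (γ ^ k * (1 - γ)) :=
    mul_lt_mul_of_pos_right ht (by positivity)
  have a2 : collisionTime α β γ (k+1) * (γ ^ k * (1 - γ)) =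
      β ^ k * (1 - β) * ((β * (1 - α * γ)) / (γ * (1 - α * β))) := by
    have : collisionTime α β γ (k+1) * (γ ^ k * (1 - γ)) =
      (collisionTime α β γ (k+1) * (γ ^ (k+1) * ((1 - γ) / (1 - α * γ)))) * ((1 - α * γ) / γ) := by
      generalize 1 - α * γ = c at h2
      rw [pow_succ]
      field_simp
    rw [this, h0]
    generalize 1 - α * γ = c at h2
    generalize 1 - α * β = d at h1
    rw [pow_succ]
    field_simp
  have a3 : (β * (1 - α * γ)) / (γ * (1 - α * β)) ≤ 1 := by
    rw [div_le_one (by positivity)]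
    nlinarith [H.bg]
  have a4 : β ^ k * (1 - β) * ((β * (1 - α * γ)) / (γ * (1 - α * β))) ≤ β ^ k * (1 - β) * 1 :=
    mul_le_mul_of_nonneg_left a3 (by positivity)
  linarith

theorem free_lt (H : SP α β γ) {i k : ℕ} (hik : i < k) :
    ∀ {t : ℝ}, t < collisionTime α β γ k → freeTraj β γ k t < freeTraj β γ i t := by
  induction k, hik using Nat.le_induction with
  | base => intro t ht; exact H.free_succ i ht
  | succ k hk ih =>
    intro t ht
    exact (H.free_succ k ht).trans (ih (ht.trans (H.T_anti (Nat.lt_succ_self k))))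

/-- `P j t`: the cluster at time t is made of the indices at least j. -/
def P (α β γ : ℝ) (j : ℕ) (t : ℝ) : Prop :=
  1 ≤ j ∧ collisionTime α β γ j ≤ t ∧ ∀ i, 1 ≤ i → i < j → t < collisionTime α β γ i

theorem exP (H : SP α β γ) {t : ℝ} (ht : 0 < t) : ∃ j, P α β γ j t := by
  classical
  have h := H.T_small ht
  refine ⟨Nat.find h, (Nat.find_spec h).1, (Nat.find_spec h).2, ?_⟩
  intro i hi hij
  have := Nat.find_min h hij
  by_contra hc
  exact this ⟨hi, not_lt.1 hc⟩

theorem mkP (H : SP α β γ) {j : ℕ} {t : ℝ} (hj : 1 ≤ j) (h1 : collisionTime α β γ j ≤ t)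
    (h2 : j = 1 ∨ t < collisionTime α β γ (j - 1)) : P α β γ j t := by
  refine ⟨hj, h1, fun i hi hij => ?_⟩
  rcases h2 with h2 | h2
  · omega
  · exact h2.trans_le (H.T_anti.antitone (by omega))

noncomputable def B (α β γ : ℝ) : ℕ → ℝ → ℝ
  | 0, t => barycenter α β γ 1 t
  | (k+1), t => if k = 0 then barycenter α β γ 1 t else
      if collisionTime α β γ k ≤ t then B α β γ k t else barycenter α β γ (k+1) t

theorem B_val (H : SP α β γ) {j : ℕ} {t : ℝ} (hP : P α β γ j t) {k : ℕ} (hk : j ≤ k) :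
    B α β γ k t = barycenter α β γ j t := by
  obtain ⟨h1, h2, h3⟩ := hP
  induction k, hk using Nat.le_induction with
  | base =>
    obtain ⟨n, rfl⟩ : ∃ n, j = n + 1 := ⟨j - 1, by omega⟩
    rw [B]
    split_ifs with a b
    · subst a; rfl
    · exact absurd (h3 n (by omega) (by omega)) (not_lt.2 b)
    · rfl
  | succ k hk ih =>
    rw [B, if_neg (by omega), if_pos ((H.T_anti.antitone hk).trans h2), ih]

theorem bary_cont (H : SP α β γ) (k : ℕ) : Continuous (barycenter α β γ k) := by
  rw [funext (H.bary_eq k)]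
  fun_prop

theorem P_self (H : SP α β γ) {k : ℕ} (hk : 1 ≤ k) : P α β γ k (collisionTime α β γ k) :=
  ⟨hk, le_rfl, fun _ _ hij => H.T_anti hij⟩

theorem B_cont (H : SP α β γ) (k : ℕ) : Continuous (B α β γ k) := by
  induction k with
  | zero => exact H.bary_cont 1
  | succ k ih =>
    by_cases hk : k = 0
    · have : B α β γ (k+1) = barycenter α β γ 1 := by
        funext t; rw [B, if_pos hk]
      rw [this]; exact H.bary_cont 1
    · have : B α β γ (k+1) = fun t =>
        if collisionTime α β γ k ≤ t then B α β γ k t else barycenter α β γ (k+1) t := by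
        funext t; rw [B, if_neg hk]
      rw [this]
      refine Continuous.if_le ih (H.bary_cont _) continuous_const continuous_id ?_
      intro t ht
      subst ht
      rw [H.B_val (H.P_self (by omega)) le_rfl, H.bary_coll]

noncomputable def Y (α β γ : ℝ) (k : ℕ) (t : ℝ) : ℝ :=
  if collisionTime α β γ k ≤ t then B α β γ k t else freeTraj β γ k t

theorem Y_cont (H : SP α β γ) {k : ℕ} (hk : 1 ≤ k) : Continuous (Y α β γ k) := by
  unfold Y
  refine Continuous.if_le (H.B_cont k) ?_ continuous_const continuous_id ?_
  · unfold freeTraj; fun_prop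
  · intro t ht
    subst ht
    rw [H.B_val (H.P_self hk) le_rfl, H.free_coll]

theorem Y_free {k : ℕ} {t : ℝ} (h : t < collisionTime α β γ k) :
    Y α β γ k t = freeTraj β γ k t := if_neg (not_le.2 h)

theorem Y_bary (H : SP α β γ) {j : ℕ} {t : ℝ} (hP : P α β γ j t) {k : ℕ} (hk : j ≤ k) :
    Y α β γ k t = barycenter α β γ j t := by
  unfold Y
  rw [if_pos ((H.T_anti.antitone hk).trans hP.2.1), H.B_val hP hk]

theorem Y_lt_small (H : SP α β γ) {j : ℕ} {t : ℝ} (hP : P α β γ j t) {i k : ℕ} (hi : 1 ≤ i)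
    (hij : i < j) (hik : i < k) : Y α β γ k t < Y α β γ i t := by
  rw [Y_free (hP.2.2 i hi hij)]
  by_cases hk : k < j
  · rw [Y_free (hP.2.2 k (by omega) hk)]
    exact H.free_lt hik (hP.2.2 k (by omega) hk)
  · rw [H.Y_bary hP (not_lt.1 hk)]
    obtain ⟨n, rfl⟩ : ∃ n, j = n + 1 := ⟨j - 1, by omega⟩
    have hn := hP.2.2 n (by omega) (by omega)
    refine (H.bary_lt_free n hn).trans_le ?_
    rcases (show i ≤ n by omega).eq_or_lt with h | h
    · rw [h]
    · exact (H.free_lt h hn).le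

theorem Y_eq_iff (H : SP α β γ) {j : ℕ} {t : ℝ} (hP : P α β γ j t) {i k : ℕ} (hi : 1 ≤ i)
    (hk : 1 ≤ k) : Y α β γ i t = Y α β γ k t ↔ i = k ∨ (j ≤ i ∧ j ≤ k) := by
  constructor
  · intro h
    by_contra hc
    push Not at hc
    rcases lt_or_gt_of_ne hc.1 with h1 | h1
    · have : i < j := by by_contra h2; have := hc.2 (by omega); omega
      exact (H.Y_lt_small hP hi this h1).ne' h
    · have : k < j := by by_contra h2; have := hc.2 (by omega); omega
      exact (H.Y_lt_small hP hk this h1).ne h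
  · rintro (h | ⟨h1, h2⟩)
    · rw [h]
    · rw [H.Y_bary hP h1, H.Y_bary hP h2]

noncomputable abbrev V (α β γ : ℝ) (k : {k : ℕ // 1 ≤ k}) (s : ℝ) : ℝ :=
  stickyVel (fun k : {k : ℕ // 1 ≤ k} => α ^ (k : ℕ))
    (fun k : {k : ℕ // 1 ≤ k} => 1 - γ ^ (k : ℕ)) (fun k => Y α β γ (k : ℕ)) k s

theorem V_free (H : SP α β γ) {j : ℕ} {t : ℝ} (hP : P α β γ j t) (k : {k : ℕ // 1 ≤ k})
    (hk : (k : ℕ) < j) : V α β γ k t = 1 - γ ^ (k : ℕ) := by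
  have hU : ∀ a : {i : {k : ℕ // 1 ≤ k} // Y α β γ i t = Y α β γ k t}, a = ⟨k, rfl⟩ := by
    intro a
    rcases (H.Y_eq_iff hP a.1.2 k.2).1 a.2 with h | h
    · exact Subtype.ext (Subtype.ext h)
    · omega
  let _ : Unique {i : {k : ℕ // 1 ≤ k} // Y α β γ i t = Y α β γ k t} := ⟨⟨⟨k, rfl⟩⟩, hU⟩
  unfold V stickyVel
  rw [tsum_fintype, tsum_fintype, Fintype.sum_unique, Fintype.sum_unique]
  have hd : ((default : {i : {k : ℕ // 1 ≤ k} // Y α β γ i t = Y α β γ k t}) : {k : ℕ // 1 ≤ k}) = k := rfl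
  rw [hd]
  have := pow_pos H.a0 (k : ℕ)
  field_simp

theorem V_clus (H : SP α β γ) {j : ℕ} {t : ℝ} (hP : P α β γ j t) (k : {k : ℕ // 1 ≤ k})
    (hk : j ≤ (k : ℕ)) : V α β γ k t = 1 - γ ^ j * ((1 - α) / (1 - α * γ)) := by
  let e : {i : ℕ // j ≤ i} ≃ {i : {k : ℕ // 1 ≤ k} // Y α β γ i t = Y α β γ k t} :=
    { toFun := fun i => ⟨⟨i.1, hP.1.trans i.2⟩,
        (H.Y_eq_iff hP (hP.1.trans i.2) k.2).2 (Or.inr ⟨i.2, hk⟩)⟩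
      invFun := fun a => ⟨a.1.1, by
        rcases (H.Y_eq_iff hP a.1.2 k.2).1 a.2 with h | h
        · omega
        · exact h.1⟩
      left_inv := fun _ => rfl
      right_inv := fun _ => rfl }
  rw [← H.vel_eq j]
  unfold V stickyVel
  congr 1
  · congr 1
    exact (e.tsum_eq (fun a => α ^ (a.1.1 : ℕ))).symm
  · exact (e.tsum_eq (fun a => α ^ (a.1.1 : ℕ) * (1 - γ ^ (a.1.1 : ℕ)))).symm

theorem hasDeriv (H : SP α β γ) (k : {k : ℕ // 1 ≤ k}) {t : ℝ} (ht : 0 < t)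
    (hn : t ∉ range (collisionTime α β γ)) : HasDerivAt (Y α β γ k) (V α β γ k t) t := by
  obtain ⟨j, hP⟩ := H.exP ht
  by_cases hk : (k : ℕ) < j
  · rw [H.V_free hP k hk]
    have h1 : HasDerivAt (freeTraj β γ k) (1 - γ ^ (k : ℕ)) t := by
      unfold freeTraj
      simpa using ((hasDerivAt_id t).mul_const (1 - γ ^ (k : ℕ))).const_add (β ^ (k : ℕ))
    refine h1.congr_of_eventuallyEq ?_
    filter_upwards [gt_mem_nhds (hP.2.2 k k.2 hk)] with s hs
    exact Y_free hs
  · rw [not_lt] at hk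
    rw [H.V_clus hP k hk]
    have h1 : HasDerivAt (barycenter α β γ j) (1 - γ ^ j * ((1 - α) / (1 - α * γ))) t := by
      rw [funext (H.bary_eq j)]
      simpa using ((hasDerivAt_id t).mul_const (1 - γ ^ j * ((1 - α) / (1 - α * γ)))).const_add
        (β ^ j * ((1 - α) / (1 - α * β)))
    refine h1.congr_of_eventuallyEq ?_
    have hlt : collisionTime α β γ j < t := lt_of_le_of_ne hP.2.1 (fun h => hn ⟨j, h⟩)
    by_cases hj : j = 1
    · filter_upwards [lt_mem_nhds hlt] with s hs
      exact H.Y_bary (H.mkP hP.1 hs.le (Or.inl hj)) hk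
    · have := hP.1
      filter_upwards [lt_mem_nhds hlt, gt_mem_nhds (hP.2.2 (j-1) (by omega) (by omega))] with s hs hs2
      exact H.Y_bary (H.mkP hP.1 hs.le (Or.inr hs2)) hk

theorem V_bdd (H : SP α β γ) (k : {k : ℕ // 1 ≤ k}) {t : ℝ} (ht : 0 < t) : |V α β γ k t| ≤ 1 := by
  obtain ⟨j, hP⟩ := H.exP ht
  have hp (n : ℕ) : γ ^ n ≤ 1 := pow_le_one₀ H.g0.le H.g1.le
  have hp0 (n : ℕ) : 0 < γ ^ n := pow_pos H.g0 n
  have h2 := H.pos2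
  by_cases hk : (k : ℕ) < j
  · rw [H.V_free hP k hk, abs_le]
    constructor <;> linarith [hp k, hp0 k]
  · rw [H.V_clus hP k (not_lt.1 hk), abs_le]
    have a0 : 0 ≤ (1 - α) / (1 - α * γ) := div_nonneg (by linarith [H.a1]) h2.le
    have a1 : (1 - α) / (1 - α * γ) ≤ 1 := by
      rw [div_le_one h2]; nlinarith [H.a0, H.g1]
    have b0 := mul_nonneg (hp0 j).le a0
    have b1 := mul_le_one₀ (hp j) a0 a1
    constructor <;> linarith

theorem V_int (H : SP α β γ) (k : {k : ℕ // 1 ≤ k}) {t : ℝ} (ht : 0 ≤ t) :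
    IntervalIntegrable (V α β γ k) MeasureTheory.volume 0 t := by
  rw [intervalIntegrable_iff_integrableOn_Ioc_of_le ht]
  have hc : ∀ᵐ s ∂(MeasureTheory.volume : MeasureTheory.Measure ℝ),
      s ∉ range (collisionTime α β γ) :=
    (countable_range (collisionTime α β γ)).ae_notMem _
  have hae : deriv (Y α β γ k) =ᵐ[MeasureTheory.volume.restrict (Ioc 0 t)] V α β γ k := by
    filter_upwards [MeasureTheory.ae_restrict_of_ae hc,
      MeasureTheory.ae_restrict_mem measurableSet_Ioc] with s h1 h2
    exact (H.hasDeriv k h2.1 h1).deriv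
  have hm : MeasureTheory.AEStronglyMeasurable (V α β γ k)
      (MeasureTheory.volume.restrict (Ioc 0 t)) :=
    (measurable_deriv (Y α β γ k)).aestronglyMeasurable.congr hae
  refine MeasureTheory.IntegrableOn.of_bound (by simp) hm 1 ?_
  filter_upwards [MeasureTheory.ae_restrict_mem measurableSet_Ioc] with s h2
  exact H.V_bdd k h2.1

theorem main (H : SP α β γ) :
    IsStickySolution (fun k : {k : ℕ // 1 ≤ k} => α ^ (k : ℕ))
        (fun k : {k : ℕ // 1 ≤ k} => β ^ (k : ℕ))
        (fun k : {k : ℕ // 1 ≤ k} => 1 - γ ^ (k : ℕ)) (fun k => Y α β γ (k : ℕ)) := by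
  have h0 : ∀ k : ℕ, Y α β γ k 0 = β ^ k := fun k => by
    rw [Y_free (H.T_pos k)]; simp [freeTraj]
  refine ⟨⟨fun k => (H.Y_cont k.2).continuousOn, fun k => h0 k, ?_⟩, ?_⟩
  · intro k t ht
    have := MeasureTheory.integral_eq_of_hasDerivAt_off_countable_of_le (Y α β γ k) (V α β γ k) ht
      (countable_range (collisionTime α β γ)) (H.Y_cont k.2).continuousOn
      (fun s hs => H.hasDeriv k hs.1.1 hs.2) (H.V_int k ht)
    have e := h0 k
    change Y α β γ k t = β ^ (k : ℕ) + ∫ s in (0:ℝ)..t, V α β γ k s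
    rw [this, e]; ring
  · intro i j t₀ ht₀ he t ht
    change Y α β γ i t₀ = Y α β γ j t₀ at he
    change Y α β γ i t = Y α β γ j t
    rcases ht₀.eq_or_lt with h | h
    · subst h
      rw [h0, h0] at he
      rw [pow_right_injective₀ H.b0 (by linarith [H.bg, H.g1]) he]
    · obtain ⟨J, hP⟩ := H.exP h
      obtain ⟨J', hP'⟩ := H.exP (h.trans_le ht)
      have hJ : J' ≤ J := by
        by_contra hc
        have := hP'.2.2 J hP.1 (by omega)
        linarith [hP.2.1]
      rw [H.Y_eq_iff hP i.2 j.2] at he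
      rw [H.Y_eq_iff hP' i.2 j.2]
      omega

end SP

theorem explicit_one_dimensional_sticky_solution (α β γ : ℝ)
    (hβ : 0 < β) (hβγ : β < γ) (hγ1 : γ < 1) (hα : 0 < α) (hα1 : α < 1 / (1 + β + γ)) :
    ∃ y : {k : ℕ // 1 ≤ k} → ℝ → ℝ,
      (∀ k : {k : ℕ // 1 ≤ k}, ∀ t : ℝ, 0 ≤ t → t < collisionTime α β γ (k : ℕ) →
        y k t = freeTraj β γ (k : ℕ) t) ∧
      (∀ k : {k : ℕ // 1 ≤ k}, ∀ j : ℕ, 1 ≤ j → j ≤ (k : ℕ) → ∀ t : ℝ,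
        collisionTime α β γ j ≤ t → t < collisionTime α β γ (j - 1) →
        y k t = barycenter α β γ j t) ∧
      (∀ k : {k : ℕ // 1 ≤ k}, ∀ t : ℝ, collisionTime α β γ 1 ≤ t →
        y k t = barycenter α β γ 1 t) ∧
      IsStickySolution (fun k : {k : ℕ // 1 ≤ k} => α ^ (k : ℕ))
        (fun k : {k : ℕ // 1 ≤ k} => β ^ (k : ℕ))
        (fun k : {k : ℕ // 1 ≤ k} => 1 - γ ^ (k : ℕ)) y := by
  have ha : α < 1 := by
    refine hα1.trans ?_
    rw [div_lt_one (by linarith)]; linarith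
  have H : SP α β γ := ⟨hα, ha, hβ, hβγ, hγ1⟩
  exact ⟨fun k => SP.Y α β γ k, fun k t _ h => SP.Y_free h,
    fun k j hj hk t h1 h2 => H.Y_bary (H.mkP hj h1 (Or.inr h2)) hk,
    fun k t h => H.Y_bary (H.mkP le_rfl h (Or.inl rfl)) k.2, H.main⟩
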